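/- arXiv:1807.08725 — 6 statements merged into one kernel-verified Lean document; each statement's English description precedes it below -/
import Mathlib

section
/- Let κ satisfy Assumption 1 with constant L > 0, let λ ≥ 0 and σ ≥ 0, and let y* be any global minimizer over y ≥ 0 of the function h(y) = (1/2)(y−σ)² + λκ(y). Then max(σ − λL, 0) ≤ y* ≤ σ. -/
/-- Assumption 1: `κ` is concave, nondecreasing and `L`-Lipschitz on `[0, ∞)`,
with `κ(0) = 0`. -/
def Assumption1 (κ : ℝ → ℝ) (L : ℝ) : Prop :=
  ConcaveOn ℝ (Set.Ici 0) κ ∧ MonotoneOn κ (Set.Ici 0) ∧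
    LipschitzOnWith (Real.toNNReal L) κ (Set.Ici 0) ∧ κ 0 = 0

/-- any global minimizer `y*` over `y ≥ 0` of
`h(y) = ½(y - σ)² + λκ(y)` satisfies `max(σ - λL, 0) ≤ y* ≤ σ`. -/
theorem prox_scalar_bounds (κ : ℝ → ℝ) (L : ℝ) (hL : 0 < L) (hκ : Assumption1 κ L)
    (lam σ : ℝ) (hlam : 0 ≤ lam) (hσ : 0 ≤ σ) (y : ℝ) (hy : 0 ≤ y)
    (hmin : ∀ z : ℝ, 0 ≤ z →
      (1 / 2) * (y - σ) ^ 2 + lam * κ y ≤ (1 / 2) * (z - σ) ^ 2 + lam * κ z) :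
    max (σ - lam * L) 0 ≤ y ∧ y ≤ σ := by
  obtain ⟨-, hmono, hlip, -⟩ := hκ
  refine ⟨max_le ?_ hy, ?_⟩
  · by_contra! h
    have hz : 0 ≤ σ - lam * L := hy.trans h.le
    have hdist := hlip.dist_le_mul (σ - lam * L) hz y hy
    rw [Real.coe_toNNReal L hL.le, Real.dist_eq, Real.dist_eq,
      abs_of_pos (sub_pos.2 h)] at hdist
    have hinc := mul_le_mul_of_nonneg_left ((le_abs_self _).trans hdist) hlam
    nlinarith [hmin _ hz, mul_pos (sub_pos.2 h) (sub_pos.2 h)]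
  · by_contra! h
    have hinc := mul_le_mul_of_nonneg_left (hmono hσ hy h.le) hlam
    nlinarith [hmin σ hσ, mul_pos (sub_pos.2 h) (sub_pos.2 h)]
end

section
/- Let κ satisfy Assumption 1, let λ ≥ 0, and let 0 ≤ σ₁ < σ₂. If y₁ is any global minimizer over y ≥ 0 of y ↦ (1/2)(y−σ₁)² + λκ(y) and y₂ is any global minimizer over y ≥ 0 of y ↦ (1/2)(y−σ₂)² + λκ(y), then y₁ ≤ y₂. -/
/-- monotonicity of the scalar proximal step: if `0 ≤ σ₁ < σ₂`
and `y₁`, `y₂` are global minimizers over `y ≥ 0` of `y ↦ ½(y - σᵢ)² + λκ(y)`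
for `i = 1, 2` respectively, then `y₁ ≤ y₂`. -/
theorem prox_scalar_monotone (κ : ℝ → ℝ) (L : ℝ) (hL : 0 < L) (hκ : Assumption1 κ L)
    (lam : ℝ) (hlam : 0 ≤ lam) (σ₁ σ₂ : ℝ) (hσ₁ : 0 ≤ σ₁) (hσ : σ₁ < σ₂)
    (y₁ y₂ : ℝ) (hy₁ : 0 ≤ y₁) (hy₂ : 0 ≤ y₂)
    (hmin₁ : ∀ z : ℝ, 0 ≤ z →
      (1 / 2) * (y₁ - σ₁) ^ 2 + lam * κ y₁ ≤ (1 / 2) * (z - σ₁) ^ 2 + lam * κ z)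
    (hmin₂ : ∀ z : ℝ, 0 ≤ z →
      (1 / 2) * (y₂ - σ₂) ^ 2 + lam * κ y₂ ≤ (1 / 2) * (z - σ₂) ^ 2 + lam * κ z) :
    y₁ ≤ y₂ := by
  have h₁ := hmin₁ y₂ hy₂
  have h₂ := hmin₂ y₁ hy₁
  have h : 0 ≤ (σ₂ - σ₁) * (y₂ - y₁) := by linarith
  exact sub_nonneg.mp (nonneg_of_mul_nonneg_right h (sub_pos.mpr hσ))
end

section
/- Let E be a finite-dimensional real inner product space, let f : E → ℝ be differentiable with ρ-Lipschitz gradient (‖∇f(x) − ∇f(y)‖ ≤ ρ‖x−y‖ for all x, y), let g : E → ℝ be any function, and let τ > ρ. Fix V ∈ E, set Z = V − (1/τ)∇f(V), and suppose X⁺ is a global minimizer over E of X ↦ (1/2)‖X−Z‖² + (1/τ)g(X). Then f(X⁺) + g(X⁺) ≤ f(V) + g(V) − ((τ−ρ)/2)‖X⁺ − V‖². -/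
open Set in
/-- The descent lemma: a differentiable function whose gradient is `ρ`-Lipschitz lies below its
quadratic upper model. -/
theorem le_quadratic_of_gradient_lipschitz {E : Type*} [NormedAddCommGroup E]
    [InnerProductSpace ℝ E] [CompleteSpace E] {f : E → ℝ} {ρ : ℝ} (hf : Differentiable ℝ f)
    (hlip : ∀ x y : E, ‖gradient f x - gradient f y‖ ≤ ρ * ‖x - y‖) (x y : E) :
    f y ≤ f x + inner ℝ (gradient f x) (y - x) + ρ / 2 * ‖y - x‖ ^ 2 := by
  set d := y - x with hd
  have hline : ∀ t : ℝ, HasDerivAt (fun t : ℝ => f (x + t • d))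
      (inner ℝ (gradient f (x + t • d)) d) t := fun t => by
    have hpath : HasDerivAt (fun t : ℝ => x + t • d) d t := by
      simpa using ((hasDerivAt_id t).smul_const d).const_add x
    simpa [Function.comp_def] using
      (hf (x + t • d)).hasGradientAt.hasFDerivAt.comp_hasDerivAt t hpath
  have hmodel : ∀ t : ℝ, HasDerivAt
      (fun t : ℝ => f x + t * inner ℝ (gradient f x) d + ρ / 2 * ‖d‖ ^ 2 * t ^ 2)
      (inner ℝ (gradient f x) d + ρ * ‖d‖ ^ 2 * t) t := fun t => by
    refine (((hasDerivAt_id' t).mul_const (inner ℝ (gradient f x) d)).const_add (f x)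
      |>.add ((hasDerivAt_pow 2 t).const_mul (ρ / 2 * ‖d‖ ^ 2))).congr_deriv ?_
    norm_num
    ring
  have hbound : ∀ t ∈ Ico (0 : ℝ) 1, inner ℝ (gradient f (x + t • d)) d ≤
      inner ℝ (gradient f x) d + ρ * ‖d‖ ^ 2 * t := fun t ht => by
    have hgrad := hlip (x + t • d) x
    rw [add_sub_cancel_left, norm_smul, Real.norm_of_nonneg ht.1] at hgrad
    have hinner := (real_inner_le_norm (gradient f (x + t • d) - gradient f x) d).trans
      (mul_le_mul_of_nonneg_right hgrad (norm_nonneg d))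
    rw [inner_sub_left] at hinner
    linarith
  have hle := image_le_of_deriv_right_le_deriv_boundary
    (fun t _ => (hline t).continuousAt.continuousWithinAt)
    (fun t _ => (hline t).hasDerivWithinAt) (by simp)
    (fun t _ => (hmodel t).continuousAt.continuousWithinAt)
    (fun t _ => (hmodel t).hasDerivWithinAt) hbound (right_mem_Icc.2 zero_le_one)
  simpa [hd] using hle

/-- sufficient decrease of one proximal-gradient step: if `f` is
differentiable with `ρ`-Lipschitz gradient, `τ > ρ`, `Z = V - (1/τ)∇f(V)`, and `X⁺`
globally minimizes `X ↦ ½‖X - Z‖² + (1/τ)g(X)`, then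
`f(X⁺) + g(X⁺) ≤ f(V) + g(V) - ((τ-ρ)/2)‖X⁺ - V‖²`. -/
theorem prox_grad_sufficient_decrease {E : Type*} [NormedAddCommGroup E]
    [InnerProductSpace ℝ E] [FiniteDimensional ℝ E]
    (f : E → ℝ) (ρ : ℝ) (hf : Differentiable ℝ f)
    (hlip : ∀ x y : E, ‖gradient f x - gradient f y‖ ≤ ρ * ‖x - y‖)
    (g : E → ℝ) (τ : ℝ) (hτ : ρ < τ) (V Xp : E)
    (hXp : ∀ X : E,
      (1 / 2) * ‖Xp - (V - (1 / τ) • gradient f V)‖ ^ 2 + (1 / τ) * g Xp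
        ≤ (1 / 2) * ‖X - (V - (1 / τ) • gradient f V)‖ ^ 2 + (1 / τ) * g X) :
    f Xp + g Xp ≤ f V + g V - ((τ - ρ) / 2) * ‖Xp - V‖ ^ 2 := by
  rcases eq_or_ne Xp V with rfl | hne
  · simp
  have hρ : 0 ≤ ρ := nonneg_of_mul_nonneg_left ((norm_nonneg _).trans (hlip Xp V))
    (norm_pos_iff.2 (sub_ne_zero.2 hne))
  have hτ_pos : 0 < τ := hρ.trans_lt hτ
  have hdescent := le_quadratic_of_gradient_lipschitz hf hlip V Xp
  have hmin := hXp V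
  rw [← sub_add, sub_sub_cancel, norm_add_sq_real, real_inner_smul_right,
    real_inner_comm] at hmin
  have hscaled := mul_le_mul_of_nonneg_left hmin hτ_pos.le
  have hcancel : τ * (1 / τ) = 1 := mul_one_div_cancel hτ_pos.ne'
  linear_combination hdescent + hscaled +
    (g V - g Xp - inner ℝ (gradient f V) (Xp - V)) * hcancel
end

section
/- Let E be a finite-dimensional real inner product space, let f : E → ℝ be differentiable with ρ-Lipschitz gradient, let ḡ : E → ℝ be any function such that F_τ := f + ḡ is bounded below with infimum F_τ^min, and let constants L ≥ 0, D ≥ 1 and τ satisfy τ > ρ + DL; set η = τ − ρ − DL. Suppose sequences (X_t)_{t≥1} and (V_t)_{t≥1} in E satisfy, for every t ≥ 1: (a) F_τ(V_t) ≤ F_τ(X_t), and (b) X_{t+1} is a global minimizer over E of X ↦ (1/2)‖X − (V_t − (1/τ)∇f(V_t))‖² + (1/τ)ḡ(X). Then for every T ≥ 1, min_{t=1,…,T} (1/2)‖X_{t+1} − V_t‖² ≤ (F_τ(X₁) − F_τ^min)/(ηT). -/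
/-- The quadratic upper bound for a function whose gradient is `ρ`-Lipschitz. -/
theorem le_add_inner_gradient_add_sq {E : Type*} [NormedAddCommGroup E]
    [InnerProductSpace ℝ E] [CompleteSpace E] {f : E → ℝ} {ρ : ℝ} (hf : Differentiable ℝ f)
    (hlip : ∀ x y : E, ‖gradient f x - gradient f y‖ ≤ ρ * ‖x - y‖) (x d : E) :
    f (x + d) ≤ f x + inner ℝ (gradient f x) d + ρ / 2 * ‖d‖ ^ 2 := by
  have hderiv : ∀ s : ℝ, HasDerivAt (fun s : ℝ => f (x + s • d))
      (inner ℝ (gradient f (x + s • d)) d) s := by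
    intro s
    have hline : HasDerivAt (fun s : ℝ => x + s • d) d s := by
      simpa using ((hasDerivAt_id s).smul_const d).const_add x
    have h := (hf (x + s • d)).hasGradientAt.hasFDerivAt.comp_hasDerivAt s hline
    simpa [Function.comp_def] using h
  have hbound : ∀ s : ℝ, HasDerivAt
      (fun s : ℝ => f x + s * inner ℝ (gradient f x) d + ρ / 2 * ‖d‖ ^ 2 * s ^ 2)
      (inner ℝ (gradient f x) d + ρ * ‖d‖ ^ 2 * s) s := by
    intro s
    refine ((((hasDerivAt_id' s).mul_const (inner ℝ (gradient f x) d)).const_add (f x)).add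
      (((hasDerivAt_id' s).pow 2).const_mul (ρ / 2 * ‖d‖ ^ 2))).congr_deriv ?_
    simp only [Nat.cast_ofNat]
    ring
  have key := image_le_of_deriv_right_le_deriv_boundary (a := 0) (b := 1)
    (fun s _ => (hderiv s).continuousAt.continuousWithinAt)
    (fun s _ => (hderiv s).hasDerivWithinAt) (by simp)
    (fun s _ => (hbound s).continuousAt.continuousWithinAt)
    (fun s _ => (hbound s).hasDerivWithinAt) (fun s hs => by
      have h₁ := real_inner_le_norm (gradient f (x + s • d) - gradient f x) d
      have h₂ := hlip (x + s • d) x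
      rw [inner_sub_left] at h₁
      rw [add_sub_cancel_left, norm_smul, Real.norm_of_nonneg hs.1] at h₂
      have h₃ := mul_le_mul_of_nonneg_right h₂ (norm_nonneg d)
      linarith) (Set.right_mem_Icc.2 zero_le_one)
  simpa using key

/-- One proximal gradient step with step size `1 / τ` decreases the objective `f + g`. -/
theorem proximal_gradient_step_le {E : Type*} [NormedAddCommGroup E]
    [InnerProductSpace ℝ E] [CompleteSpace E] {f g : E → ℝ} {ρ τ : ℝ} (hf : Differentiable ℝ f)
    (hlip : ∀ x y : E, ‖gradient f x - gradient f y‖ ≤ ρ * ‖x - y‖) (hτ : 0 < τ) {x v : E}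
    (hx : (1 / 2) * ‖x - (v - (1 / τ) • gradient f v)‖ ^ 2 + (1 / τ) * g x
      ≤ (1 / 2) * ‖v - (v - (1 / τ) • gradient f v)‖ ^ 2 + (1 / τ) * g v) :
    f x + g x + (τ - ρ) * ((1 / 2) * ‖x - v‖ ^ 2) ≤ f v + g v := by
  have hdesc := le_add_inner_gradient_add_sq hf hlip v (x - v)
  rw [add_sub_cancel] at hdesc
  rw [show x - (v - (1 / τ) • gradient f v) = (x - v) + (1 / τ) • gradient f v by abel,
    sub_sub_cancel, norm_add_sq_real, real_inner_smul_right, real_inner_comm] at hx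
  have hscaled : τ * (1 / τ) = 1 := mul_one_div_cancel hτ.ne'
  have hmul : 0 ≤ τ * ((1 / τ) * g v - (1 / τ) * g x
      - (1 / 2) * ‖x - v‖ ^ 2 - (1 / τ) * inner ℝ (gradient f v) (x - v)) :=
    mul_nonneg hτ.le (by linarith)
  have hexp : τ * ((1 / τ) * g v - (1 / τ) * g x
      - (1 / 2) * ‖x - v‖ ^ 2 - (1 / τ) * inner ℝ (gradient f v) (x - v))
      = g v - g x - τ / 2 * ‖x - v‖ ^ 2 - inner ℝ (gradient f v) (x - v) := by
    linear_combination (g v - g x - inner ℝ (gradient f v) (x - v)) * hscaled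
  linarith

/-- If each residual `r t`, scaled by `η`, is at most the decrease of `a` from `t` to `t + 1`,
then some residual among the first `T` is at most the average total decrease. -/
theorem exists_le_div_of_mul_le_sub {a r : ℕ → ℝ} {η m : ℝ} (hη : 0 < η)
    (hm : ∀ t, m ≤ a t) (hstep : ∀ t, 1 ≤ t → η * r t ≤ a t - a (t + 1))
    {T : ℕ} (hT : 1 ≤ T) :
    ∃ t : ℕ, 1 ≤ t ∧ t ≤ T ∧ r t ≤ (a 1 - m) / (η * T) := by
  have hT' : (0 : ℝ) < T := by exact_mod_cast hT
  by_contra! hlt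
  have hsum : ∀ n : ℕ, n ≤ T → n * ((a 1 - m) / T) ≤ a 1 - a (n + 1) ∧
      (1 ≤ n → n * ((a 1 - m) / T) < a 1 - a (n + 1)) := by
    intro n
    induction n with
    | zero => simp
    | succ n ih =>
      intro hn
      have h₁ := mul_lt_mul_of_pos_left (hlt (n + 1) (by omega) hn) hη
      have h₂ := hstep (n + 1) (by omega)
      have h₃ := (ih (by omega)).1
      have h₄ : η * ((a 1 - m) / (η * T)) = (a 1 - m) / T := by field_simp
      have h₅ : ((n + 1 : ℕ) : ℝ) * ((a 1 - m) / T) < a 1 - a (n + 1 + 1) := by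
        push_cast
        linarith
      exact ⟨h₅.le, fun _ => h₅⟩
  have h := (hsum T le_rfl).2 hT
  rw [mul_div_cancel₀ _ hT'.ne'] at h
  linarith [hm (T + 1)]

/-- Corollary 1(ii), rate of the NORT iterations: if `f` has
`ρ`-Lipschitz gradient, `F_τ = f + ḡ` is bounded below with infimum `F_τ^min`,
`τ > ρ + DL` with `η = τ - ρ - DL`, and for every `t ≥ 1` the point `V t` satisfies
`F_τ(V t) ≤ F_τ(X t)` while `X (t+1)` is a global minimizer of the proximal-step
objective at `V t - (1/τ)∇f(V t)`, then for every `T ≥ 1`,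
`min_{1 ≤ t ≤ T} ½‖X_{t+1} - V_t‖² ≤ (F_τ(X₁) - F_τ^min)/(ηT)`. -/
theorem nort_min_residual_rate {E : Type*} [NormedAddCommGroup E]
    [InnerProductSpace ℝ E] [FiniteDimensional ℝ E]
    (f : E → ℝ) (ρ : ℝ) (hf : Differentiable ℝ f)
    (hlip : ∀ x y : E, ‖gradient f x - gradient f y‖ ≤ ρ * ‖x - y‖)
    (gbar : E → ℝ) (Fτmin : ℝ)
    (hFτmin : IsGLB (Set.range fun x => f x + gbar x) Fτmin)
    (L D τ : ℝ) (hL : 0 ≤ L) (hD : 1 ≤ D) (hτ : ρ + D * L < τ)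
    (X V : ℕ → E)
    (ha : ∀ t : ℕ, 1 ≤ t → f (V t) + gbar (V t) ≤ f (X t) + gbar (X t))
    (hb : ∀ t : ℕ, 1 ≤ t → ∀ Y : E,
      (1 / 2) * ‖X (t + 1) - (V t - (1 / τ) • gradient f (V t))‖ ^ 2
          + (1 / τ) * gbar (X (t + 1))
        ≤ (1 / 2) * ‖Y - (V t - (1 / τ) • gradient f (V t))‖ ^ 2 + (1 / τ) * gbar Y) :
    ∀ T : ℕ, 1 ≤ T → ∃ t : ℕ, 1 ≤ t ∧ t ≤ T ∧
      (1 / 2) * ‖X (t + 1) - V t‖ ^ 2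
        ≤ (f (X 1) + gbar (X 1) - Fτmin) / ((τ - ρ - D * L) * T) := by
  intro T hT
  have hmin : ∀ x, Fτmin ≤ f x + gbar x := fun x => hFτmin.1 ⟨x, rfl⟩
  have hη : 0 < τ - ρ - D * L := by linarith
  have hDL : 0 ≤ D * L := mul_nonneg (zero_le_one.trans hD) hL
  refine exists_le_div_of_mul_le_sub (a := fun t => f (X t) + gbar (X t)) hη
    (fun t => hmin (X t)) (fun t ht => ?_) hT
  have hVX := ha t ht
  rcases eq_or_ne (X (t + 1)) (V t) with heq | hne
  · simpa [heq] using hVX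
  · have hd : 0 < ‖X (t + 1) - V t‖ := norm_pos_iff.2 (sub_ne_zero.2 hne)
    have hρ : 0 ≤ ρ := nonneg_of_mul_nonneg_left
      ((norm_nonneg _).trans (hlip (X (t + 1)) (V t))) hd
    have hstep := proximal_gradient_step_le hf hlip (by linarith : 0 < τ) (hb t ht (V t))
    have hDLsq : 0 ≤ D * L * ((1 / 2) * ‖X (t + 1) - V t‖ ^ 2) := by positivity
    linarith
end

section
/- Let β ∈ [1/2, 1), A > 0 and t₀ ∈ ℕ. Let (r_t)_{t∈ℕ} be a nonnegative nonincreasing real sequence with r_{t₀} ≤ 1 such that r_t^{2−2β} ≤ A(r_t − r_{t+1}) for every t ≥ t₀. Then for all t ≥ t₀, r_t ≤ (A/(1+A))^{t−t₀} · r_{t₀}; i.e., the sequence converges to zero at a linear rate. -/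
/-- (KL convergence rate, case `β ∈ [1/2, 1)`): if `(r_t)` is
nonnegative and nonincreasing with `r_{t₀} ≤ 1` and `r_t^{2-2β} ≤ A(r_t - r_{t+1})`
for all `t ≥ t₀`, then `r_t ≤ (A/(1+A))^{t-t₀} r_{t₀}` for all `t ≥ t₀`. -/
theorem kl_rate_beta_ge_half (β : ℝ) (hβ₁ : 1 / 2 ≤ β) (hβ₂ : β < 1)
    (A : ℝ) (hA : 0 < A) (t₀ : ℕ)
    (r : ℕ → ℝ) (hnn : ∀ t, 0 ≤ r t) (hanti : Antitone r) (hr₀ : r t₀ ≤ 1)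
    (h : ∀ t, t₀ ≤ t → r t ^ ((2 : ℝ) - 2 * β) ≤ A * (r t - r (t + 1))) :
    ∀ t, t₀ ≤ t → r t ≤ (A / (1 + A)) ^ (t - t₀) * r t₀ := by
  intro t ht
  induction t, ht using Nat.le_induction with
  | base => simp
  | succ t ht ih =>
    have hself : r t ≤ r t ^ ((2 : ℝ) - 2 * β) :=
      Real.self_le_rpow_of_le_one (hnn t) ((hanti ht).trans hr₀) (by linarith)
    have hstep : r (t + 1) ≤ A / (1 + A) * r t := by
      rw [div_mul_eq_mul_div, le_div_iff₀ (by positivity)]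
      linarith [h t ht, hanti t.le_succ]
    calc r (t + 1) ≤ A / (1 + A) * r t := hstep
      _ ≤ A / (1 + A) * ((A / (1 + A)) ^ (t - t₀) * r t₀) := by gcongr
      _ = (A / (1 + A)) ^ (t + 1 - t₀) * r t₀ := by
        rw [Nat.sub_add_comm ht, pow_succ']
        ring
end

section
/- Let β ∈ (0, 1/2), A > 0 and t₀ ∈ ℕ. Let (r_t)_{t∈ℕ} be a nonnegative nonincreasing real sequence such that r_t^{2−2β} ≤ A(r_t − r_{t+1}) for every t ≥ t₀. Then there exists a constant M > 0 such that for all t > t₀, r_t ≤ M · (t − t₀)^{−1/(1−2β)}. -/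
/-- A Bernoulli inequality for negative exponents. -/
lemma one_add_mul_one_sub_le_rpow_neg {x p : ℝ} (hx : 0 < x) (hp : 0 ≤ p) :
    1 + p * (1 - x) ≤ x ^ (-p) := by
  rw [Real.rpow_def_of_pos hx]
  have h₁ := Real.add_one_le_exp (Real.log x * -p)
  have h₂ := mul_le_mul_of_nonneg_left (Real.log_le_sub_one_of_pos hx) hp
  linarith

/-- The power `a ^ (-p)` grows by at least `p / A` along a step `a ↦ b` with
`a ^ (1 + p) ≤ A * (a - b)`. -/
lemma rpow_neg_add_div_le_of_rpow_le {a b p A : ℝ} (ha : 0 < a) (hb : 0 < b) (hp : 0 ≤ p)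
    (hA : 0 < A) (h : a ^ (1 + p) ≤ A * (a - b)) :
    a ^ (-p) + p / A ≤ b ^ (-p) := by
  have hap : 0 < a ^ (-p) := Real.rpow_pos_of_pos ha _
  have hB := one_add_mul_one_sub_le_rpow_neg (div_pos hb ha) hp
  rw [Real.div_rpow hb.le ha.le, le_div_iff₀ hap] at hB
  refine le_trans ?_ hB
  have hmul : a ^ (-p) * a ^ (1 + p) = a := by
    rw [← Real.rpow_add ha]; simp
  have h₁ : a ≤ a ^ (-p) * (A * (a - b)) :=
    hmul.symm.le.trans (mul_le_mul_of_nonneg_left h hap.le)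
  have h₂ : 1 / A ≤ (1 - b / a) * a ^ (-p) := by
    rw [one_sub_div ha.ne', div_mul_eq_mul_div, div_le_div_iff₀ hA ha]
    linarith
  have h₃ := mul_le_mul_of_nonneg_left h₂ hp
  rw [mul_one_div] at h₃
  linarith

/-- KL convergence rate, case `β ∈ (0, 1/2)`: if `(r_t)` is
nonnegative and nonincreasing and `r_t^{2-2β} ≤ A(r_t - r_{t+1})` for all `t ≥ t₀`,
then `r_t = O((t - t₀)^{-1/(1-2β)})`. -/
theorem kl_rate_beta_lt_half (β : ℝ) (hβ₁ : 0 < β) (hβ₂ : β < 1 / 2)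
    (A : ℝ) (hA : 0 < A) (t₀ : ℕ)
    (r : ℕ → ℝ) (hnn : ∀ t, 0 ≤ r t) (hanti : Antitone r)
    (h : ∀ t, t₀ ≤ t → r t ^ ((2 : ℝ) - 2 * β) ≤ A * (r t - r (t + 1))) :
    ∃ M : ℝ, 0 < M ∧ ∀ t, t₀ < t →
      r t ≤ M * ((t - t₀ : ℕ) : ℝ) ^ (-(1 / (1 - 2 * β)) : ℝ) := by
  obtain ⟨p, hp⟩ : ∃ p, p = 1 - 2 * β := ⟨_, rfl⟩
  have hp₀ : 0 < p := by linarith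
  rw [← hp]
  rw [show (2 : ℝ) - 2 * β = 1 + p by linarith] at h
  have key : ∀ n : ℕ, 0 < r (t₀ + n) → p / A * n ≤ r (t₀ + n) ^ (-p) := by
    intro n
    induction n with
    | zero => intro hr; simpa using (Real.rpow_pos_of_pos hr (-p)).le
    | succ n ih =>
      intro hr
      have hr' : 0 < r (t₀ + n) := hr.trans_le (hanti (by omega))
      have hstep := rpow_neg_add_div_le_of_rpow_le hr' hr hp₀.le hA (h (t₀ + n) (by omega))
      have := ih hr'
      push_cast
      linarith
  have hpA : 0 < p / A := div_pos hp₀ hA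
  refine ⟨(p / A) ^ (-(1 / p)), Real.rpow_pos_of_pos hpA _, fun t ht => ?_⟩
  obtain ⟨n, rfl⟩ := Nat.exists_eq_add_of_le ht.le
  have hn : (0 : ℝ) < n := by exact_mod_cast (by omega : 0 < n)
  rw [Nat.add_sub_cancel_left, ← Real.mul_rpow hpA.le hn.le]
  rcases (hnn (t₀ + n)).eq_or_lt with h₀ | h₀
  · rw [← h₀]; positivity
  · have hle := Real.rpow_le_rpow_of_nonpos (z := -(1 / p)) (mul_pos hpA hn) (key n h₀)
      (by simpa using hp₀.le)
    rwa [← Real.rpow_mul h₀.le, neg_mul_neg, mul_one_div_cancel hp₀.ne', Real.rpow_one] at hle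
end
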